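/- arXiv:2210.04798 — 7 statements merged into one kernel-verified Lean document; each statement's English description precedes it below -/
import Mathlib

section
/- Let A be a commutative ring and B a commutative A-algebra. Let f₁, f₂, f₃ ∈ B be nonzerodivisors in B such that B/(fᵢ) is flat as an A-module for i = 1, 2, 3. Assume that (f₁, f₂) is a good pair over A and that (f₃, f₁·f₂) is a good pair over A. Then (f₁, f₃), (f₂, f₃), (f₂, f₁·f₃) and (f₁, f₂·f₃) are good pairs over A. -/
/-- `f` is a nonzerodivisor modulo the ideal `K` of `B`:
multiplication by `f` is injective on `B ⧸ K`. -/
def IsNonZeroDivisorMod {B : Type*} [CommRing B] (f : B) (K : Ideal B) : Prop :=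
  ∀ x : B, f * x ∈ K → x ∈ K

/-- `(f, g)` is a *good pair* over `A`: `f` is a nonzerodivisor modulo `(g)`,
`g` is a nonzerodivisor modulo `(f)`, and `B ⧸ (f, g)` is flat as an `A`-module. -/
def IsGoodPair (A : Type*) {B : Type*} [CommRing A] [CommRing B] [Algebra A B]
    (f g : B) : Prop :=
  IsNonZeroDivisorMod f (Ideal.span {g}) ∧ IsNonZeroDivisorMod g (Ideal.span {f}) ∧
    Module.Flat A (B ⧸ Ideal.span ({f, g} : Set B))

open TensorProduct in
theorem flat_of_universally_inj {R N P C : Type*} [CommRing R] [AddCommGroup N] [AddCommGroup P]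
    [AddCommGroup C] [Module R N] [Module R P] [Module R C] [Module.Flat R P]
    (u : N →ₗ[R] P) (p : P →ₗ[R] C) (hex : Function.Exact u p) (hp : Function.Surjective p)
    (hu : ∀ I : Ideal R, Function.Injective (u.lTensor (R ⧸ I))) : Module.Flat R C := by
  rw [Module.Flat.iff_rTensor_injective']
  intro I
  rw [injective_iff_map_eq_zero]
  intro x hx
  obtain ⟨y, rfl⟩ := LinearMap.lTensor_surjective I hp x
  have h1 : p.lTensor R (I.subtype.rTensor P y) = 0 := by
    rw [← hx, ← LinearMap.comp_apply, ← LinearMap.comp_apply, LinearMap.lTensor_comp_rTensor,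
      LinearMap.rTensor_comp_lTensor]
  obtain ⟨z, hz⟩ := (lTensor_exact R hex hp _).1 h1
  have hI : Function.Exact I.subtype (Submodule.mkQ I) := LinearMap.exact_subtype_mkQ I
  have h2 : u.lTensor (R ⧸ I) ((Submodule.mkQ I).rTensor N z) = 0 := by
    rw [← LinearMap.comp_apply, LinearMap.lTensor_comp_rTensor, ← LinearMap.rTensor_comp_lTensor,
      LinearMap.comp_apply, hz]
    exact (rTensor_exact P hI (Submodule.mkQ_surjective I) _).2 ⟨y, rfl⟩
  have h3 := (injective_iff_map_eq_zero _).1 (hu I) _ h2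
  obtain ⟨w, rfl⟩ := (rTensor_exact N hI (Submodule.mkQ_surjective I) _).1 h3
  have h4 : u.lTensor I w = y := by
    apply Module.Flat.rTensor_preserves_injective_linearMap (M := P) I.subtype
      Subtype.val_injective
    rw [← hz, ← LinearMap.comp_apply, ← LinearMap.comp_apply, LinearMap.lTensor_comp_rTensor,
      LinearMap.rTensor_comp_lTensor]
  exact (lTensor_exact I hex hp _).2 ⟨w, h4⟩

/-- Multiplication by `f` on `B ⧸ (g)`, as an `A`-linear map. -/
noncomputable def mulQ (A : Type*) {B : Type*} [CommRing A] [CommRing B] [Algebra A B] (f g : B) :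
    (B ⧸ Ideal.span ({g} : Set B)) →ₗ[A] (B ⧸ Ideal.span ({g} : Set B)) :=
  LinearMap.mulLeft A (Ideal.Quotient.mk _ f)

theorem mulQ_mul (A : Type*) {B : Type*} [CommRing A] [CommRing B] [Algebra A B] (f f' g : B) :
    mulQ A (f * f') g = mulQ A f g ∘ₗ mulQ A f' g := by
  refine LinearMap.ext fun x => ?_
  simp only [mulQ, LinearMap.comp_apply, LinearMap.mulLeft_apply, map_mul, mul_assoc]

theorem mulQ_inj (A : Type*) {B : Type*} [CommRing A] [CommRing B] [Algebra A B] (f g : B)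
    (h : IsNonZeroDivisorMod f (Ideal.span {g})) : Function.Injective (mulQ A f g) := by
  rw [injective_iff_map_eq_zero]
  intro x
  obtain ⟨x, rfl⟩ := Ideal.Quotient.mk_surjective x
  simp only [mulQ, LinearMap.mulLeft_apply, ← map_mul, Ideal.Quotient.eq_zero_iff_mem]
  exact h x

/-- The projection `B ⧸ (g) → B ⧸ (f, g)`. -/
noncomputable def projQ (A : Type*) {B : Type*} [CommRing A] [CommRing B] [Algebra A B] (f g : B) :
    (B ⧸ Ideal.span ({g} : Set B)) →ₗ[A] (B ⧸ Ideal.span ({f, g} : Set B)) :=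
  (Ideal.Quotient.factorₐ A (Ideal.span_mono (by simp))).toLinearMap

theorem projQ_surj (A : Type*) {B : Type*} [CommRing A] [CommRing B] [Algebra A B] (f g : B) :
    Function.Surjective (projQ A f g) := by
  intro x
  obtain ⟨x, rfl⟩ := Ideal.Quotient.mk_surjective x
  exact ⟨Ideal.Quotient.mk _ x, rfl⟩

theorem projQ_exact (A : Type*) {B : Type*} [CommRing A] [CommRing B] [Algebra A B] (f g : B) :
    Function.Exact (mulQ A f g) (projQ A f g) := by
  intro x
  obtain ⟨x, rfl⟩ := Ideal.Quotient.mk_surjective x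
  have : projQ A f g (Ideal.Quotient.mk _ x) = Ideal.Quotient.mk _ x := rfl
  rw [this, Ideal.Quotient.eq_zero_iff_mem, Ideal.mem_span_pair]
  constructor
  · rintro ⟨a, b, rfl⟩
    refine ⟨Ideal.Quotient.mk _ a, ?_⟩
    simp only [mulQ, LinearMap.mulLeft_apply, ← map_mul]
    rw [Ideal.Quotient.eq, Ideal.mem_span_singleton]
    exact ⟨-b, by ring⟩
  · rintro ⟨a, ha⟩
    obtain ⟨a, rfl⟩ := Ideal.Quotient.mk_surjective a
    simp only [mulQ, LinearMap.mulLeft_apply, ← map_mul] at ha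
    rw [Ideal.Quotient.eq, Ideal.mem_span_singleton] at ha
    obtain ⟨c, hc⟩ := ha
    exact ⟨a, -c, by linear_combination hc⟩

theorem mulQ_univ (A : Type*) {B : Type*} [CommRing A] [CommRing B] [Algebra A B] (f g : B)
    (h : IsNonZeroDivisorMod f (Ideal.span {g}))
    [Module.Flat A (B ⧸ Ideal.span ({f, g} : Set B))] (I : Ideal A) :
    Function.Injective ((mulQ A f g).lTensor (A ⧸ I)) :=
  LinearMap.lTensor_injective_of_exact_of_flat _ (projQ_surj A f g) _ (mulQ_inj A f g h)
    (projQ_exact A f g) _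

theorem flat_pair_swap {A B : Type*} [CommRing A] [CommRing B] [Algebra A B] {f g : B}
    (h : Module.Flat A (B ⧸ Ideal.span ({f, g} : Set B))) :
    Module.Flat A (B ⧸ Ideal.span ({g, f} : Set B)) := by
  rwa [Set.pair_comm]

theorem IsGoodPair.swap {A B : Type*} [CommRing A] [CommRing B] [Algebra A B] {f g : B}
    (h : IsGoodPair A f g) : IsGoodPair A g f :=
  ⟨h.2.1, h.1, flat_pair_swap h.2.2⟩

theorem goodPair_left {A B : Type*} [CommRing A] [CommRing B] [Algebra A B]
    (f₁ f₂ f₃ : B) (h₂ : f₂ ∈ nonZeroDivisors B)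
    (hfl₃ : Module.Flat A (B ⧸ Ideal.span ({f₃} : Set B)))
    (h : IsGoodPair A f₃ (f₁ * f₂)) : IsGoodPair A f₁ f₃ := by
  refine ⟨?_, ?_, ?_⟩
  · intro x hx
    refine h.2.1 x ?_
    rw [show f₁ * f₂ * x = f₂ * (f₁ * x) by ring]
    exact Ideal.mul_mem_left _ _ hx
  · intro x hx
    obtain ⟨y, hy⟩ := Ideal.mem_span_singleton.1 hx
    obtain ⟨z, hz⟩ := Ideal.mem_span_singleton.1
      (h.1 (f₂ * x) (Ideal.mem_span_singleton.2 ⟨y, by linear_combination f₂ * hy⟩))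
    refine Ideal.mem_span_singleton.2 ⟨z, ?_⟩
    exact (mul_cancel_left_mem_nonZeroDivisors h₂).1 (by linear_combination hz)
  · refine flat_of_universally_inj _ _ (projQ_exact A f₁ f₃) (projQ_surj A f₁ f₃) fun I => ?_
    have := flat_pair_swap h.2.2
    have h5 := mulQ_univ A (f₁ * f₂) f₃ h.2.1 I
    rw [mul_comm, mulQ_mul, LinearMap.lTensor_comp, LinearMap.coe_comp] at h5
    exact h5.of_comp

theorem goodPair_mul {A B : Type*} [CommRing A] [CommRing B] [Algebra A B]
    (f₁ f₂ f₃ : B) (h₁ : f₁ ∈ nonZeroDivisors B)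
    (hfl₂ : Module.Flat A (B ⧸ Ideal.span ({f₂} : Set B)))
    (h₁₂ : IsGoodPair A f₁ f₂) (h₃₂ : IsGoodPair A f₃ f₂) : IsGoodPair A f₂ (f₁ * f₃) := by
  refine ⟨?_, ?_, ?_⟩
  · intro x hx
    obtain ⟨y, hy⟩ := Ideal.mem_span_singleton.1 hx
    obtain ⟨z, rfl⟩ := Ideal.mem_span_singleton.1
      (h₁₂.2.1 x (Ideal.mem_span_singleton.2 ⟨f₃ * y, by linear_combination hy⟩))
    have : f₂ * z = f₃ * y :=
      (mul_cancel_left_mem_nonZeroDivisors h₁).1 (by linear_combination hy)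
    obtain ⟨w, rfl⟩ := Ideal.mem_span_singleton.1
      (h₃₂.2.1 z (Ideal.mem_span_singleton.2 ⟨y, this⟩))
    exact Ideal.mem_span_singleton.2 ⟨w, by ring⟩
  · intro x hx
    rw [mul_assoc] at hx
    exact h₃₂.1 _ (h₁₂.1 _ hx)
  · apply flat_pair_swap
    refine flat_of_universally_inj _ _ (projQ_exact A (f₁ * f₃) f₂) (projQ_surj A _ f₂)
      fun I => ?_
    have := h₁₂.2.2
    have := h₃₂.2.2
    rw [mulQ_mul, LinearMap.lTensor_comp, LinearMap.coe_comp]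
    exact (mulQ_univ A f₁ f₂ h₁₂.1 I).comp (mulQ_univ A f₃ f₂ h₃₂.1 I)


/-- If `(f₁, f₂)` and `(f₃, f₁·f₂)` are good pairs over `A` (with each `fᵢ` a
nonzerodivisor and each `B/(fᵢ)` flat over `A`), then `(f₁, f₃)`, `(f₂, f₃)`,
`(f₂, f₁·f₃)` and `(f₁, f₂·f₃)` are good pairs over `A`. -/
theorem goodPair_of_goodPair_mul {A B : Type*} [CommRing A] [CommRing B] [Algebra A B]
    (f₁ f₂ f₃ : B)
    (h₁ : f₁ ∈ nonZeroDivisors B) (h₂ : f₂ ∈ nonZeroDivisors B)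
    (h₃ : f₃ ∈ nonZeroDivisors B)
    (hfl₁ : Module.Flat A (B ⧸ Ideal.span ({f₁} : Set B)))
    (hfl₂ : Module.Flat A (B ⧸ Ideal.span ({f₂} : Set B)))
    (hfl₃ : Module.Flat A (B ⧸ Ideal.span ({f₃} : Set B)))
    (h₁₂ : IsGoodPair A f₁ f₂) (h₃₁₂ : IsGoodPair A f₃ (f₁ * f₂)) :
    IsGoodPair A f₁ f₃ ∧ IsGoodPair A f₂ f₃ ∧
      IsGoodPair A f₂ (f₁ * f₃) ∧ IsGoodPair A f₁ (f₂ * f₃) := by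
  have h13 := goodPair_left f₁ f₂ f₃ h₂ hfl₃ h₃₁₂
  have h23 := goodPair_left f₂ f₁ f₃ h₁ hfl₃ (by rwa [mul_comm])
  exact ⟨h13, h23, goodPair_mul f₁ f₂ f₃ h₁ hfl₂ h₁₂ h23.swap,
    goodPair_mul f₂ f₁ f₃ h₂ hfl₁ h₁₂.swap h13.swap⟩
end

section
/- Let B be a commutative ring and f₁, f₂, f₃ ∈ B with f₁ and f₂ nonzerodivisors in B. Assume that f₃ is a nonzerodivisor modulo (f₁·f₂) and that f₁·f₂ is a nonzerodivisor modulo (f₃). Then: f₃ is a nonzerodivisor modulo (f₁); f₃ is a nonzerodivisor modulo (f₂); f₁ is a nonzerodivisor modulo (f₃); and f₂ is a nonzerodivisor modulo (f₃). -/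
/-- If `f₁, f₂` are nonzerodivisors of `B`, `f₃` is a nonzerodivisor modulo `(f₁·f₂)`
and `f₁·f₂` is a nonzerodivisor modulo `(f₃)`, then `f₃` is a nonzerodivisor modulo
`(f₁)` and modulo `(f₂)`, and `f₁`, `f₂` are nonzerodivisors modulo `(f₃)`. -/
theorem nonZeroDivisorMod_of_mul {B : Type*} [CommRing B] (f₁ f₂ f₃ : B)
    (h₁ : f₁ ∈ nonZeroDivisors B) (h₂ : f₂ ∈ nonZeroDivisors B)
    (h₃ : IsNonZeroDivisorMod f₃ (Ideal.span {f₁ * f₂}))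
    (h₁₂ : IsNonZeroDivisorMod (f₁ * f₂) (Ideal.span {f₃})) :
    IsNonZeroDivisorMod f₃ (Ideal.span {f₁}) ∧
      IsNonZeroDivisorMod f₃ (Ideal.span {f₂}) ∧
      IsNonZeroDivisorMod f₁ (Ideal.span {f₃}) ∧
      IsNonZeroDivisorMod f₂ (Ideal.span {f₃}) := by
  simp only [IsNonZeroDivisorMod, Ideal.mem_span_singleton] at *
  refine ⟨?_, ?_, ?_, ?_⟩
  · rintro x ⟨y, hy⟩
    obtain ⟨z, hz⟩ := h₃ (f₂ * x) ⟨y, by linear_combination f₂ * hy⟩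
    refine ⟨z, ?_⟩
    rw [← mul_cancel_left_mem_nonZeroDivisors h₂]
    linear_combination hz
  · rintro x ⟨y, hy⟩
    obtain ⟨z, hz⟩ := h₃ (f₁ * x) ⟨y, by linear_combination f₁ * hy⟩
    refine ⟨z, ?_⟩
    rw [← mul_cancel_left_mem_nonZeroDivisors h₁]
    linear_combination hz
  · rintro x ⟨y, hy⟩
    exact h₁₂ x ⟨f₂ * y, by linear_combination f₂ * hy⟩
  · rintro x ⟨y, hy⟩
    exact h₁₂ x ⟨f₁ * y, by linear_combination f₁ * hy⟩
end

section
/- Let A be a commutative ring, B a commutative A-algebra, and f₁, f₂, f₃ ∈ B. Assume that f₁ and f₂ are nonzerodivisors modulo (f₃), that B/(f₃) is flat as an A-module, and that B/(f₃, f₁·f₂) is flat as an A-module. Then B/(f₃, f₁) and B/(f₃, f₂) are flat as A-modules. -/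
open TensorProduct in
/-- If `0 → M → C → Q → 0` is exact with `C` flat and `M → C` universally injective,
then `Q` is flat. -/
theorem flat_quot_aux {A M C Q : Type*} [CommRing A] [AddCommGroup M] [AddCommGroup C]
    [AddCommGroup Q] [Module A M] [Module A C] [Module A Q] [Module.Flat A C]
    (f : M →ₗ[A] C) (g : C →ₗ[A] Q) (hfg : Function.Exact f g) (hg : Function.Surjective g)
    (hf : ∀ I : Ideal A, Function.Injective (f.lTensor (A ⧸ I))) : Module.Flat A Q := by
  rw [Module.Flat.iff_rTensor_injective']
  intro I
  rw [injective_iff_map_eq_zero]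
  intro x hx
  obtain ⟨y, rfl⟩ := LinearMap.lTensor_surjective I hg x
  have e1 : g.lTensor A (I.subtype.rTensor C y) = 0 := by
    rw [← hx]
    simp only [← LinearMap.comp_apply, LinearMap.lTensor_comp_rTensor,
      LinearMap.rTensor_comp_lTensor]
  obtain ⟨z, hz⟩ := (lTensor_exact A hfg hg _).1 e1
  have ex : Function.Exact (I.subtype) (Submodule.mkQ I) := LinearMap.exact_subtype_mkQ I
  have hs : Function.Surjective (Submodule.mkQ I) := Submodule.mkQ_surjective I
  have e2 : (Submodule.mkQ I).rTensor M z = 0 := by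
    apply hf I
    rw [map_zero, ← LinearMap.comp_apply, LinearMap.lTensor_comp_rTensor,
      ← LinearMap.rTensor_comp_lTensor, LinearMap.comp_apply, hz]
    exact (rTensor_exact C ex hs _).2 ⟨y, rfl⟩
  obtain ⟨w, rfl⟩ := (rTensor_exact M ex hs _).1 e2
  have e3 : f.lTensor I w = y := by
    apply Module.Flat.rTensor_preserves_injective_linearMap (M := C) I.subtype
      I.injective_subtype
    rw [← hz]
    simp only [← LinearMap.comp_apply, LinearMap.lTensor_comp_rTensor,
      LinearMap.rTensor_comp_lTensor]
  exact (lTensor_exact I hfg hg _).2 ⟨w, e3⟩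

/-- Multiplication by `f` on `B ⧸ (h)` and the projection to `B ⧸ (h, f)` form an exact pair. -/
theorem exact_aux (A : Type*) {B : Type*} [CommRing A] [CommRing B] [Algebra A B] (f h : B) :
    ∃ g : (B ⧸ Ideal.span ({h} : Set B)) →ₗ[A] (B ⧸ Ideal.span ({h, f} : Set B)),
      Function.Surjective g ∧
      Function.Exact (LinearMap.mulLeft A (Ideal.Quotient.mk (Ideal.span ({h} : Set B)) f)) g := by
  have hle : Ideal.span ({h} : Set B) ≤ Ideal.span ({h, f} : Set B) :=
    Ideal.span_mono (by simp)
  refine ⟨(Ideal.Quotient.factorₐ A hle).toLinearMap, Ideal.Quotient.factor_surjective hle, ?_⟩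
  intro y
  obtain ⟨b, rfl⟩ := Ideal.Quotient.mk_surjective y
  have : (Ideal.Quotient.factorₐ A hle).toLinearMap (Ideal.Quotient.mk _ b)
    = Ideal.Quotient.mk (Ideal.span ({h, f} : Set B)) b := rfl
  rw [this, Ideal.Quotient.eq_zero_iff_mem, Ideal.mem_span_pair]
  constructor
  · rintro ⟨a, c, rfl⟩
    refine ⟨Ideal.Quotient.mk _ c, ?_⟩
    rw [LinearMap.mulLeft_apply, ← map_mul, Ideal.Quotient.eq, Ideal.mem_span_singleton']
    exact ⟨-a, by ring⟩
  · rintro ⟨c, hc⟩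
    obtain ⟨c, rfl⟩ := Ideal.Quotient.mk_surjective c
    rw [LinearMap.mulLeft_apply, ← map_mul, Ideal.Quotient.eq, Ideal.mem_span_singleton'] at hc
    obtain ⟨a, ha⟩ := hc
    exact ⟨-a, c, by linear_combination -ha⟩

theorem inj_aux (A : Type*) {B : Type*} [CommRing A] [CommRing B] [Algebra A B] (f h : B)
    (H : IsNonZeroDivisorMod f (Ideal.span {h})) :
    Function.Injective
      (LinearMap.mulLeft A (Ideal.Quotient.mk (Ideal.span ({h} : Set B)) f)) := by
  rw [injective_iff_map_eq_zero]
  intro x hx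
  obtain ⟨b, rfl⟩ := Ideal.Quotient.mk_surjective x
  rw [LinearMap.mulLeft_apply, ← map_mul, Ideal.Quotient.eq_zero_iff_mem] at hx
  exact Ideal.Quotient.eq_zero_iff_mem.2 (H b hx)

theorem flat_left_aux {A B : Type*} [CommRing A] [CommRing B] [Algebra A B]
    (f₁ f₂ f₃ : B)
    (h₁ : IsNonZeroDivisorMod f₁ (Ideal.span {f₃}))
    (h₂ : IsNonZeroDivisorMod f₂ (Ideal.span {f₃}))
    (hfl₃ : Module.Flat A (B ⧸ Ideal.span ({f₃} : Set B)))
    (hfl : Module.Flat A (B ⧸ Ideal.span ({f₃, f₁ * f₂} : Set B))) :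
    Module.Flat A (B ⧸ Ideal.span ({f₃, f₂} : Set B)) := by
  obtain ⟨g, hg, hex⟩ := exact_aux A (f₁ * f₂) f₃
  obtain ⟨g', hg', hex'⟩ := exact_aux A f₂ f₃
  refine flat_quot_aux _ g' hex' hg' fun I => ?_
  have h12 : IsNonZeroDivisorMod (f₁ * f₂) (Ideal.span {f₃}) := fun x hx =>
    h₂ x (h₁ _ (by rwa [← mul_assoc]))
  have key := LinearMap.lTensor_injective_of_exact_of_flat g hg _
    (inj_aux A _ _ h12) hex (A ⧸ I)
  rw [map_mul, LinearMap.mulLeft_mul, LinearMap.lTensor_comp] at key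
  exact Function.Injective.of_comp (f := LinearMap.lTensor (A ⧸ I) (LinearMap.mulLeft A (Ideal.Quotient.mk (Ideal.span ({f₃} : Set B)) f₁))) key

/-- If `f₁` and `f₂` are nonzerodivisors modulo `(f₃)`, `B/(f₃)` is flat over `A`
and `B/(f₃, f₁·f₂)` is flat over `A`, then `B/(f₃, f₁)` and `B/(f₃, f₂)` are flat
over `A`. -/
theorem flat_of_flat_mul {A B : Type*} [CommRing A] [CommRing B] [Algebra A B]
    (f₁ f₂ f₃ : B)
    (h₁ : IsNonZeroDivisorMod f₁ (Ideal.span {f₃}))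
    (h₂ : IsNonZeroDivisorMod f₂ (Ideal.span {f₃}))
    (hfl₃ : Module.Flat A (B ⧸ Ideal.span ({f₃} : Set B)))
    (hfl : Module.Flat A (B ⧸ Ideal.span ({f₃, f₁ * f₂} : Set B))) :
    Module.Flat A (B ⧸ Ideal.span ({f₃, f₁} : Set B)) ∧
      Module.Flat A (B ⧸ Ideal.span ({f₃, f₂} : Set B)) := by
  exact ⟨flat_left_aux f₂ f₁ f₃ h₂ h₁ hfl₃ (by rwa [mul_comm f₂ f₁]),
    flat_left_aux f₁ f₂ f₃ h₁ h₂ hfl₃ hfl⟩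
end

section
/- Let B be a commutative ring and f₁, f₂, f₃ ∈ B with f₃ a nonzerodivisor in B. If f₂ is a nonzerodivisor modulo (f₁) and f₂ is a nonzerodivisor modulo (f₃), then f₂ is a nonzerodivisor modulo (f₁·f₃). -/
/-- If `f₃` is a nonzerodivisor of `B` and `f₂` is a nonzerodivisor modulo both
`(f₁)` and `(f₃)`, then `f₂` is a nonzerodivisor modulo `(f₁·f₃)`. -/
theorem nonZeroDivisorMod_mul {B : Type*} [CommRing B] (f₁ f₂ f₃ : B)
    (h₃ : f₃ ∈ nonZeroDivisors B)
    (h₂₁ : IsNonZeroDivisorMod f₂ (Ideal.span {f₁}))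
    (h₂₃ : IsNonZeroDivisorMod f₂ (Ideal.span {f₃})) :
    IsNonZeroDivisorMod f₂ (Ideal.span {f₁ * f₃}) := by
  intro x hx
  rw [Ideal.mem_span_singleton] at hx
  obtain ⟨c, hc⟩ := hx
  obtain ⟨y, rfl⟩ := Ideal.mem_span_singleton.mp
    (h₂₃ x (Ideal.mem_span_singleton.mpr ⟨f₁ * c, by rw [hc]; ring⟩))
  have h : f₂ * y = f₁ * c := by
    apply (mul_cancel_left_mem_nonZeroDivisors h₃).mp
    linear_combination hc
  obtain ⟨d, rfl⟩ := Ideal.mem_span_singleton.mp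
    (h₂₁ y (Ideal.mem_span_singleton.mpr ⟨c, h⟩))
  exact Ideal.mem_span_singleton.mpr ⟨d, by ring⟩
end

section
/- Let B be a commutative ring and let I₁ ⊆ J₁, I₂ ⊆ J₂, I₃ ⊆ J₃ be ideals of B. Assume that (a) I₁ + I₂ = J₁ + J₂ and (b) I₃ + (I₁ ∩ I₂) = J₃ + (J₁ ∩ J₂). Then (c) I₁ + I₃ = J₁ + J₃ and (d) I₂ + (I₁ ∩ I₃) = J₂ + (J₁ ∩ J₃). -/
/-- If `I₁ ⊆ J₁`, `I₂ ⊆ J₂`, `I₃ ⊆ J₃` are ideals of `B` with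
`I₁ + I₂ = J₁ + J₂` and `I₃ + (I₁ ∩ I₂) = J₃ + (J₁ ∩ J₂)`, then
`I₁ + I₃ = J₁ + J₃` and `I₂ + (I₁ ∩ I₃) = J₂ + (J₁ ∩ J₃)`. -/
theorem ideal_sum_inter_exchange {B : Type*} [CommRing B]
    (I₁ I₂ I₃ J₁ J₂ J₃ : Ideal B)
    (hIJ₁ : I₁ ≤ J₁) (hIJ₂ : I₂ ≤ J₂) (hIJ₃ : I₃ ≤ J₃)
    (ha : I₁ + I₂ = J₁ + J₂)
    (hb : I₃ + (I₁ ⊓ I₂) = J₃ + (J₁ ⊓ J₂)) :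
    I₁ + I₃ = J₁ + J₃ ∧ I₂ + (I₁ ⊓ I₃) = J₂ + (J₁ ⊓ J₃) := by
  simp only [Submodule.add_eq_sup] at *
  have h1 : ∀ x ∈ J₁ ⊔ J₂, ∃ a ∈ I₁, ∃ b ∈ I₂, a + b = x := fun x hx =>
    Submodule.mem_sup.1 (ha ▸ hx)
  have h2 : ∀ x ∈ J₃ ⊔ (J₁ ⊓ J₂), ∃ c ∈ I₃, ∃ d ∈ I₁ ⊓ I₂, c + d = x := fun x hx =>
    Submodule.mem_sup.1 (hb ▸ hx)
  refine ⟨le_antisymm (sup_le_sup hIJ₁ hIJ₃) (sup_le ?_ ?_),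
    le_antisymm (sup_le_sup hIJ₂ (inf_le_inf hIJ₁ hIJ₃)) (sup_le ?_ ?_)⟩
  · intro x hx
    obtain ⟨a, ha1, b, hb2, rfl⟩ := h1 x (Submodule.mem_sup_left hx)
    have hbJ : b ∈ J₁ := (Submodule.add_mem_iff_right _ (hIJ₁ ha1)).1 hx
    obtain ⟨c, hc, d, hd, rfl⟩ := h2 b (Submodule.mem_sup_right ⟨hbJ, hIJ₂ hb2⟩)
    exact Submodule.mem_sup.2 ⟨a + d, add_mem ha1 hd.1, c, hc, by ring⟩
  · intro x hx
    obtain ⟨c, hc, d, hd, rfl⟩ := h2 x (Submodule.mem_sup_left hx)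
    exact Submodule.mem_sup.2 ⟨d, hd.1, c, hc, by ring⟩
  · intro x hx
    obtain ⟨a, ha1, b, hb2, rfl⟩ := h1 x (Submodule.mem_sup_right hx)
    have haJ : a ∈ J₂ := (Submodule.add_mem_iff_left _ (hIJ₂ hb2)).1 hx
    obtain ⟨c, hc, d, hd, rfl⟩ := h2 a (Submodule.mem_sup_right ⟨hIJ₁ ha1, haJ⟩)
    have hc1 : c ∈ I₁ := (Submodule.add_mem_iff_left _ hd.1).1 ha1
    exact Submodule.mem_sup.2 ⟨d + b, add_mem hd.2 hb2, c, ⟨hc1, hc⟩, by ring⟩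
  · rintro x ⟨hx1, hx3⟩
    obtain ⟨c, hc, d, hd, rfl⟩ := h2 x (Submodule.mem_sup_left hx3)
    have hc1 : c ∈ J₁ := (Submodule.add_mem_iff_left _ (hIJ₁ hd.1)).1 hx1
    obtain ⟨a, ha1, b, hb2, rfl⟩ := h1 c (Submodule.mem_sup_left hc1)
    have hbJ : b ∈ J₁ := (Submodule.add_mem_iff_right _ (hIJ₁ ha1)).1 hc1
    obtain ⟨c', hc', d', hd', rfl⟩ := h2 b (Submodule.mem_sup_right ⟨hbJ, hIJ₂ hb2⟩)
    have hc2 : c' ∈ I₂ := (Submodule.add_mem_iff_left _ hd'.2).1 hb2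
    have h3 : a + d' ∈ I₃ := by
      have := sub_mem hc hc'
      rwa [show a + (c' + d') - c' = a + d' by ring] at this
    exact Submodule.mem_sup.2
      ⟨c' + d, add_mem hc2 hd.2, a + d', ⟨add_mem ha1 hd'.1, h3⟩, by ring⟩
end

section
/- Let A be a commutative ring and let B, C, D be commutative A-algebras that are flat as A-modules. Let π_C : C → B and π_D : D → B be surjective A-algebra homomorphisms. Then the fiber product C ×_B D = {(c,d) ∈ C × D : π_C(c) = π_D(d)} (an A-subalgebra of C × D) is flat as an A-module. -/
open TensorProduct in
theorem flat_of_exact_aux {A K M N : Type*} [CommRing A] [AddCommGroup K] [AddCommGroup M]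
    [AddCommGroup N] [Module A K] [Module A M] [Module A N] [Module.Flat A M] [Module.Flat A N]
    (i : K →ₗ[A] M) (p : M →ₗ[A] N) (hi : Function.Injective i) (he : Function.Exact i p)
    (hp : Function.Surjective p) : Module.Flat A K := by
  rw [Module.Flat.iff_rTensor_injective']
  intro I
  have h1 : Function.Injective (i.lTensor I) :=
    LinearMap.lTensor_injective_of_exact_of_flat p hp i hi he I
  have h2 : Function.Injective (I.subtype.rTensor M) :=
    Module.Flat.rTensor_preserves_injective_linearMap _ I.injective_subtype
  have h : (i.lTensor A) ∘ₗ (I.subtype.rTensor K) = (I.subtype.rTensor M) ∘ₗ (i.lTensor I) := by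
    rw [LinearMap.lTensor_comp_rTensor, LinearMap.rTensor_comp_lTensor]
  have h3 : Function.Injective ((i.lTensor A) ∘ₗ (I.subtype.rTensor K)) := by
    rw [h]; exact h2.comp h1
  rw [LinearMap.coe_comp] at h3
  exact h3.of_comp

theorem flat_prod_aux {A C D : Type*} [CommRing A] [AddCommGroup C] [AddCommGroup D]
    [Module A C] [Module A D] [Module.Flat A C] [Module.Flat A D] : Module.Flat A (C × D) := by
  rw [Module.Flat.iff_rTensor_injective']
  intro I x y hxy
  apply (TensorProduct.prodRight A A I C D).injective
  have hC : Function.Injective (I.subtype.rTensor C) :=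
    Module.Flat.rTensor_preserves_injective_linearMap _ I.injective_subtype
  have hD : Function.Injective (I.subtype.rTensor D) :=
    Module.Flat.rTensor_preserves_injective_linearMap _ I.injective_subtype
  have h : (TensorProduct.prodRight A A A C D).toLinearMap ∘ₗ (I.subtype.rTensor (C × D)) =
      ((I.subtype.rTensor C).prodMap (I.subtype.rTensor D)) ∘ₗ
        (TensorProduct.prodRight A A I C D).toLinearMap := by
    ext <;> simp
  have hx := LinearMap.congr_fun h x
  have hy := LinearMap.congr_fun h y
  simp only [LinearMap.comp_apply] at hx hy
  rw [hxy, hy] at hx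
  exact ((hC.prodMap hD) hx).symm


/-- If `B`, `C`, `D` are commutative `A`-algebras that are flat as `A`-modules and
`π_C : C → B`, `π_D : D → B` are surjective `A`-algebra homomorphisms, then the fiber
product `C ×_B D = {(c,d) ∈ C × D | π_C c = π_D d}` (realized as the equalizer
subalgebra of `C × D`) is flat as an `A`-module. -/
theorem flat_fiberProduct {A B C D : Type*} [CommRing A] [CommRing B] [CommRing C]
    [CommRing D] [Algebra A B] [Algebra A C] [Algebra A D]
    [Module.Flat A B] [Module.Flat A C] [Module.Flat A D]
    (πC : C →ₐ[A] B) (πD : D →ₐ[A] B)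
    (hC : Function.Surjective πC) (hD : Function.Surjective πD) :
    Module.Flat A
      (AlgHom.equalizer (πC.comp (AlgHom.fst A C D)) (πD.comp (AlgHom.snd A C D))) := by
  have := flat_prod_aux (A := A) (C := C) (D := D)
  refine flat_of_exact_aux (AlgHom.equalizer _ _).val.toLinearMap
    ((πC.comp (AlgHom.fst A C D)).toLinearMap - (πD.comp (AlgHom.snd A C D)).toLinearMap)
    Subtype.val_injective ?_ ?_
  · intro x
    simp [sub_eq_zero]
  · intro b
    obtain ⟨c, rfl⟩ := hC b
    exact ⟨(c, 0), by simp⟩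
end

section
/- Let A be a commutative ring, let B, C, D be commutative A-algebras with B flat as an A-module, and let π_C : C → B and π_D : D → B be surjective A-algebra homomorphisms. Then for every commutative A-algebra A', the canonical A'-module homomorphism ρ : (C ×_B D) ⊗_A A' → (C ⊗_A A') ×_{B ⊗_A A'} (D ⊗_A A'), determined by (c,d) ⊗ a' ↦ (c ⊗ a', d ⊗ a'), is an isomorphism. -/
set_option synthInstance.maxHeartbeats 1000000
set_option maxHeartbeats 1000000
open TensorProduct

/-- Let `B`, `C`, `D` be commutative `A`-algebras with `B` flat over `A`, and let
`π_C : C → B`, `π_D : D → B` be surjective `A`-algebra homomorphisms.  Write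
`S = C ×_B D` for the fiber product (the equalizer subalgebra of `C × D`).  Then for
every commutative `A`-algebra `A'`, the canonical homomorphism
`ρ : S ⊗_A A' → (C ⊗_A A') × (D ⊗_A A')`, determined by
`(c,d) ⊗ a' ↦ (c ⊗ a', d ⊗ a')`, is injective with image exactly the fiber product
`(C ⊗_A A') ×_{B ⊗_A A'} (D ⊗_A A')`; i.e. `ρ` induces an isomorphism
`(C ×_B D) ⊗_A A' ≅ (C ⊗_A A') ×_{B ⊗_A A'} (D ⊗_A A')`. -/
theorem fiberProduct_baseChange {A B C D A' : Type*} [CommRing A] [CommRing B]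
    [CommRing C] [CommRing D] [CommRing A'] [Algebra A B] [Algebra A C] [Algebra A D]
    [Algebra A A'] [Module.Flat A B]
    (πC : C →ₐ[A] B) (πD : D →ₐ[A] B)
    (hC : Function.Surjective πC) (hD : Function.Surjective πD)
    -- the fiber product `S = C ×_B D` as a subalgebra of `C × D`
    (S : Subalgebra A (C × D))
    (hS : S = AlgHom.equalizer (πC.comp (AlgHom.fst A C D)) (πD.comp (AlgHom.snd A C D)))
    -- the canonical map `ρ : S ⊗[A] A' → (C ⊗[A] A') × (D ⊗[A] A')`
    (ρ : (S ⊗[A] A') →ₐ[A] (C ⊗[A] A') × (D ⊗[A] A'))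
    (hρ : ρ = (Algebra.TensorProduct.map ((AlgHom.fst A C D).comp S.val)
          (AlgHom.id A A')).prod
        (Algebra.TensorProduct.map ((AlgHom.snd A C D).comp S.val) (AlgHom.id A A'))) :
    (∀ (x : S) (a' : A'), ρ (x ⊗ₜ[A] a') = ((x : C × D).1 ⊗ₜ[A] a', (x : C × D).2 ⊗ₜ[A] a')) ∧
      Function.Injective ρ ∧
      AlgHom.range ρ =
        AlgHom.equalizer
          ((Algebra.TensorProduct.map πC (AlgHom.id A A')).comp
            (AlgHom.fst A (C ⊗[A] A') (D ⊗[A] A')))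
          ((Algebra.TensorProduct.map πD (AlgHom.id A A')).comp
            (AlgHom.snd A (C ⊗[A] A') (D ⊗[A] A'))) := by
  let f : (C × D) →ₗ[A] B :=
    πC.toLinearMap ∘ₗ LinearMap.fst A C D - πD.toLinearMap ∘ₗ LinearMap.snd A C D
  let g : S →ₗ[A] (C × D) := S.val.toLinearMap
  have hf : Function.Surjective f := by
    intro b
    obtain ⟨c, rfl⟩ := hC b
    exact ⟨(c, 0), by simp [f]⟩
  have hg : Function.Injective g := Subtype.val_injective
  have H : Function.Exact g f := by
    intro y
    have h1 : f y = 0 ↔ y ∈ S := by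
      rw [hS, AlgHom.mem_equalizer]
      simp [f, sub_eq_zero]
    rw [h1]
    exact ⟨fun h => ⟨⟨y, h⟩, rfl⟩, fun ⟨x, hx⟩ => hx ▸ x.2⟩
  have hinj : Function.Injective (g.rTensor A') := by
    have h := LinearMap.lTensor_injective_of_exact_of_flat f hf g hg H A'
    rwa [LinearMap.lTensor_inj_iff_rTensor_inj] at h
  have hex : Function.Exact (g.rTensor A') (f.rTensor A') := rTensor_exact A' H hf
  let e := TensorProduct.prodLeft A A C D A'
  have hρe : ∀ x, ρ x = e (g.rTensor A' x) := by
    intro x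
    subst hρ
    induction x with
    | zero => simp only [map_zero]
    | add x y hx hy => rw [map_add, map_add, map_add, hx, hy]
    | tmul x a => rfl
  have hfe : ∀ y, f.rTensor A' y = Algebra.TensorProduct.map πC (AlgHom.id A A') (e y).1
      - Algebra.TensorProduct.map πD (AlgHom.id A A') (e y).2 := by
    intro y
    induction y with
    | zero => simp only [map_zero, Prod.fst_zero, Prod.snd_zero, sub_zero]
    | add x y hx hy =>
      rw [map_add, map_add, hx, hy, Prod.fst_add, Prod.snd_add, map_add, map_add]
      abel
    | tmul x a =>
      obtain ⟨c, d⟩ := x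
      simp [f, e]
  refine ⟨?_, ?_, ?_⟩
  · intro x a
    rw [hρe]
    rfl
  · intro x y h
    rw [hρe, hρe] at h
    exact hinj (e.injective h)
  · ext z
    obtain ⟨y, rfl⟩ := e.surjective z
    have h2 : e y ∈ AlgHom.range ρ ↔ y ∈ Set.range (g.rTensor A') := by
      constructor
      · rintro ⟨x, hx⟩
        exact ⟨x, e.injective ((hρe x).symm.trans hx)⟩
      · rintro ⟨x, rfl⟩
        exact ⟨x, hρe x⟩
    rw [h2, ← hex y, hfe, sub_eq_zero, AlgHom.mem_equalizer]
    rfl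
end
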